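/- Let d ∈ ℕ, τ ≥ d+1, n ≥ τ⁴, and p ∈ P_τ. Then for every k ∈ ℕ₀^d ∩ n S_d^o (with k_{d+1} := n − ‖k‖₁) satisfying max_{1≤i≤d+1} |δ_{k_i,p_i}/(√n p_i)| ≤ 1.076 τ √(log n / n), one has | log( P_{n,p}(k) / ( n^{−d/2} φ_{Σ_p}(δ_{k,p}) ) ) | ≤ 96.25 τ³ (log n)^{3/2} / n^{1/2}. -/

import Mathlib

open MeasureTheory Matrix Real Finset
open scoped BigOperators ENNReal NNReal

noncomputable section

/-- Extended probability vector: `p` on `Fin d`, together with `p (d+1) = 1 - ∑ p`. -/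
def extP (d : ℕ) (p : Fin d → ℝ) : Fin (d + 1) → ℝ :=
  Fin.snoc p (1 - ∑ i, p i)

/-- Extended coordinate vector: `v` on `Fin d`, together with `v (d+1) = n - ∑ v`. -/
def extV (d n : ℕ) (v : Fin d → ℝ) : Fin (d + 1) → ℝ :=
  Fin.snoc v ((n : ℝ) - ∑ i, v i)

/-- `δ_{y,q} = (y - n q) / √n`. -/
def del (n : ℕ) (q y : ℝ) : ℝ := (y - n * q) / Real.sqrt n

/-- The vector `δ_{v,p}`. -/
def delVec (d n : ℕ) (p v : Fin d → ℝ) : Fin d → ℝ := fun i => del n (p i) (v i)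

/-- The covariance matrix `Σ_p = diag p - p pᵀ`. -/
def covM (d : ℕ) (p : Fin d → ℝ) : Matrix (Fin d) (Fin d) ℝ :=
  Matrix.diagonal p - Matrix.vecMulVec p p

/-- The quadratic form `x ↦ xᵀ Σ_p⁻¹ x`. -/
def quadForm (d : ℕ) (p x : Fin d → ℝ) : ℝ := x ⬝ᵥ ((covM d p)⁻¹ *ᵥ x)

/-- The Gaussian density `φ_{Σ_p}`. -/
def gaussDens (d : ℕ) (p y : Fin d → ℝ) : ℝ :=
  Real.exp (-(1 / 2) * quadForm d p y) /
    Real.sqrt ((2 * Real.pi) ^ d * ∏ i, extP d p i)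

/-- The `Multinomial(n, p)` probability mass function. -/
def multinomialPMF (d n : ℕ) (p : Fin d → ℝ) (k : Fin d → ℕ) : ℝ :=
  if ∑ i, k i ≤ n then
    ((n.factorial : ℝ) / ((∏ i, ((k i).factorial : ℝ)) * ((n - ∑ i, k i).factorial : ℝ))) *
      ((∏ i, p i ^ k i) * (1 - ∑ i, p i) ^ (n - ∑ i, k i))
  else 0

/-- The interior `S_d^o` of the unit simplex. -/
def simplexInt (d : ℕ) : Set (Fin d → ℝ) :=
  {s | (∀ i, s i ∈ Set.Ioo (0 : ℝ) 1) ∧ ∑ i, s i < 1}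

/-- The set `P_τ`. -/
def Ptau (d : ℕ) (τ : ℝ) : Set (Fin d → ℝ) :=
  {s | s ∈ simplexInt d ∧ ∀ i : Fin (d + 1), (extP d s i)⁻¹ ≤ τ}

/-- Cast a vector of naturals to a real vector. -/
def castK (d : ℕ) (k : Fin d → ℕ) : Fin d → ℝ := fun i => (k i : ℝ)

/-- The bulk set `B_{n,p}` (integer vectors). -/
def bulk (d n : ℕ) (τ : ℝ) (p : Fin d → ℝ) : Set (Fin d → ℕ) :=
  {k | (∀ i, 0 < k i) ∧ ∑ i, k i < n ∧
    ∀ i : Fin (d + 1),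
      |del n (extP d p i) (extV d n (castK d k) i) / (Real.sqrt n * extP d p i)| ≤
        τ * Real.sqrt (Real.log n / n)}

/-- The bulk set `B_{n,p}` (real vectors). -/
def bulkReal (d n : ℕ) (τ : ℝ) (p : Fin d → ℝ) : Set (Fin d → ℝ) :=
  {x | ∀ i : Fin (d + 1),
    |del n (extP d p i) (extV d n x i) / (Real.sqrt n * extP d p i)| ≤
      τ * Real.sqrt (Real.log n / n)}

/-- The main term in the local expansion. -/
def mainTerm (d n : ℕ) (p v : Fin d → ℝ) : ℝ :=
  (n : ℝ) ^ (-(1 : ℝ) / 2) * ∑ i : Fin (d + 1),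
    (del n (extP d p i) (extV d n v i) ^ 3 / (6 * extP d p i ^ 2) -
      del n (extP d p i) (extV d n v i) / (2 * extP d p i))

/-- The bound on the remainder `R_{n,p}(k)`. -/
def errBound (d n : ℕ) (τ : ℝ) (p v : Fin d → ℝ) : ℝ :=
  (n : ℝ)⁻¹ * ∑ i : Fin (d + 1),
    (21 * |del n (extP d p i) (extV d n v i)| ^ 4 / extP d p i ^ 3 +
      10 * |del n (extP d p i) (extV d n v i)| ^ 2 / extP d p i ^ 2 + 2 * τ / 3)

/-- The log-ratio of the multinomial pmf over the corresponding normal density. -/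
def logRatio (d n : ℕ) (p : Fin d → ℝ) (k : Fin d → ℕ) : ℝ :=
  Real.log (multinomialPMF d n p k /
    ((n : ℝ) ^ (-(d : ℝ) / 2) * gaussDens d p (delVec d n p (castK d k))))

/-- The law of a `Multinomial(n,p)` random vector, as a measure on `ℝ^d`. -/
def multinomialLaw (d n : ℕ) (p : Fin d → ℝ) : Measure (Fin d → ℝ) :=
  Measure.sum fun k : Fin d → ℕ =>
    ENNReal.ofReal (multinomialPMF d n p k) • Measure.dirac (castK d k)

/-- The law of a `Uniform(-1/2,1/2)^d` random vector. -/
def uniformBoxLaw (d : ℕ) : Measure (Fin d → ℝ) :=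
  volume.restrict (Set.univ.pi fun _ : Fin d => Set.Ioo (-(1 : ℝ) / 2) (1 / 2))

/-- The law of a `Normal_d (n p, n Σ_p)` random vector. -/
def gaussLaw (d n : ℕ) (p : Fin d → ℝ) : Measure (Fin d → ℝ) :=
  volume.withDensity fun y =>
    ENNReal.ofReal ((n : ℝ) ^ (-(d : ℝ) / 2) * gaussDens d p (delVec d n p y))

/-- The regularized lower incomplete gamma function `γ̄(x, a)`. -/
def regGamma (x a : ℝ) : ℝ :=
  (∫ t in (0 : ℝ)..a, t ^ (x - 1) * Real.exp (-t)) / Real.Gamma x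

/-- The error of Stirling's approximation to `log n!`. -/
def stirlingErr (n : ℕ) : ℝ :=
  Real.log n.factorial -
    (n * Real.log n - n + Real.log n / 2 + Real.log (2 * Real.pi) / 2)

lemma stirlingErr_nonneg {n : ℕ} (hn : n ≠ 0) : 0 ≤ stirlingErr n :=
  sub_nonneg.2 (Stirling.le_log_factorial_stirling hn)

lemma log_stirlingSeq_le {n : ℕ} (hn : n ≠ 0) :
    Real.log (Stirling.stirlingSeq n) ≤ Real.log Real.pi / 2 + 1 / (12 * n) := by
  obtain ⟨m, rfl⟩ := Nat.exists_eq_succ_of_ne_zero hn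
  let g : ℕ → ℝ := fun j =>
    Real.log (Stirling.stirlingSeq (j + 1)) - 1 / (12 * ((j + 1 : ℕ) : ℝ))
  have hmono : Monotone g := by
    refine monotone_nat_of_le_succ fun j => ?_
    have h := Stirling.log_stirlingSeq_sdiff_le (j + 1)
    have h2 : 1 / (12 * ((j + 1 : ℕ) : ℝ) * (((j + 1 : ℕ) : ℝ) + 1)) =
        1 / (12 * ((j + 1 : ℕ) : ℝ)) - 1 / (12 * ((j + 1 + 1 : ℕ) : ℝ)) := by
      push_cast
      field_simp
      ring
    simp only [g]
    linarith
  have hlim : Filter.Tendsto g Filter.atTop (nhds (Real.log (Real.sqrt Real.pi) - 0)) := by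
    refine Filter.Tendsto.sub ?_ ?_
    · exact ((Stirling.tendsto_stirlingSeq_sqrt_pi.log (by positivity)).comp
        (Filter.tendsto_add_atTop_nat 1))
    · refine Filter.Tendsto.div_atTop tendsto_const_nhds ?_
      refine Filter.Tendsto.const_mul_atTop (by norm_num) ?_
      exact tendsto_natCast_atTop_atTop.comp (Filter.tendsto_add_atTop_nat 1)
  have h := hmono.ge_of_tendsto hlim m
  rw [Real.log_sqrt Real.pi_pos.le] at h
  simp only [g] at h
  linarith

lemma stirlingErr_le {n : ℕ} (hn : n ≠ 0) : stirlingErr n ≤ 1 / (12 * n) := by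
  have h := log_stirlingSeq_le hn
  have hn' : (n : ℝ) ≠ 0 := by exact_mod_cast hn
  rw [Stirling.log_stirlingSeq_formula, Real.log_div hn' (Real.exp_ne_zero _), Real.log_exp,
    Real.log_mul two_ne_zero hn'] at h
  rw [stirlingErr, Real.log_mul two_ne_zero Real.pi_ne_zero]
  linarith

lemma covM_inv {d : ℕ} {p : Fin d → ℝ} (hp : ∀ i, p i ≠ 0) (hs : 1 - ∑ i, p i ≠ 0) :
    (covM d p)⁻¹ = Matrix.diagonal (fun i => (p i)⁻¹) +
      Matrix.of fun _ _ => (1 - ∑ i, p i)⁻¹ := by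
  refine Matrix.inv_eq_right_inv ?_
  ext i j
  have e : (covM d p * (Matrix.diagonal (fun i => (p i)⁻¹) +
      Matrix.of fun _ _ : Fin d => (1 - ∑ i, p i)⁻¹) : Matrix (Fin d) (Fin d) ℝ) i j =
      (if i = j then p i * (p j)⁻¹ else 0) - p i * p j * (p j)⁻¹ +
        (p i - p i * ∑ l, p l) * (1 - ∑ l, p l)⁻¹ := by
    rw [covM, Matrix.mul_add, Matrix.add_apply, Matrix.mul_diagonal, Matrix.sub_apply,
      Matrix.diagonal_apply, Matrix.vecMulVec_apply]
    simp only [Matrix.mul_apply, Matrix.sub_apply, Matrix.of_apply, Matrix.vecMulVec_apply,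
      Matrix.diagonal_apply, ← Finset.sum_mul, ← Finset.mul_sum, Finset.sum_sub_distrib,
      Finset.sum_ite_eq, Finset.mem_univ, if_true]
    split_ifs <;> ring
  rw [e, Matrix.one_apply]
  have := hp j
  by_cases h : i = j
  · subst h
    simp
    field_simp
    ring
  · simp [h]
    field_simp
    ring

lemma quadForm_eq {d : ℕ} {p : Fin d → ℝ} (hp : ∀ i, p i ≠ 0) (hs : 1 - ∑ i, p i ≠ 0)
    (x : Fin d → ℝ) :
    quadForm d p x = ∑ i, x i ^ 2 / p i + (∑ i, x i) ^ 2 / (1 - ∑ i, p i) := by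
  rw [quadForm, covM_inv hp hs, Matrix.add_mulVec, dotProduct_add]
  congr 1
  · simp only [dotProduct, Matrix.mulVec_diagonal]
    exact Finset.sum_congr rfl fun i _ => by ring
  · simp only [dotProduct, Matrix.mulVec, Matrix.of_apply]
    rw [← Finset.mul_sum, ← Finset.sum_mul]
    ring

lemma abs_log_one_add_le {x : ℝ} (hx : |x| ≤ 0.95) : |Real.log (1 + x)| ≤ 20 * |x| := by
  have h := Real.abs_log_sub_add_sum_range_le (x := -x) (by rw [abs_neg]; linarith) 0
  simp only [Finset.range_zero, Finset.sum_empty, zero_add, sub_neg_eq_add, abs_neg, pow_one] at h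
  refine h.trans ?_
  rw [div_le_iff₀ (by linarith)]
  nlinarith [abs_nonneg x]

lemma abs_entropy_sub_quadratic_le {x : ℝ} (hx : |x| ≤ 0.95) :
    |(1 + x) * Real.log (1 + x) - x - x ^ 2 / 2| ≤ 39.5 * |x| ^ 3 := by
  have h := Real.abs_log_sub_add_sum_range_le (x := -x) (by rw [abs_neg]; linarith) 2
  simp only [Finset.sum_range_succ, Finset.range_zero, Finset.sum_empty, zero_add,
    sub_neg_eq_add, abs_neg, pow_one, Nat.cast_zero, Nat.cast_one, div_one] at h
  have h' : |-x + (-x) ^ (1 + 1) / (1 + 1) + Real.log (1 + x)| ≤ 20 * |x| ^ 3 := by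
    refine h.trans ?_
    rw [div_le_iff₀ (by linarith)]
    have : 0 ≤ |x| ^ 3 := by positivity
    norm_num
    nlinarith
  have e : (1 + x) * Real.log (1 + x) - x - x ^ 2 / 2 =
      (1 + x) * (-x + (-x) ^ (1 + 1) / (1 + 1) + Real.log (1 + x)) + -(x ^ 3 / 2) := by ring
  have h1 : |1 + x| ≤ 1.95 := by
    have := abs_le.1 hx
    rw [abs_le]
    constructor <;> linarith
  rw [e]
  refine (abs_add_le _ _).trans ?_
  rw [abs_mul, abs_neg, abs_div, abs_pow, abs_two]
  have := mul_le_mul h1 h' (abs_nonneg _) (by norm_num)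
  linarith

/-- The relative deviation `k_i / (n p_i) - 1`, over all `d + 1` coordinates. -/
def relDev (d n : ℕ) (p v : Fin d → ℝ) (i : Fin (d + 1)) : ℝ :=
  del n (extP d p i) (extV d n v i) / (Real.sqrt n * extP d p i)

lemma extV_eq_mul_one_add_relDev {d n : ℕ} (hn : n ≠ 0) {p v : Fin d → ℝ} {i : Fin (d + 1)}
    (hp : extP d p i ≠ 0) :
    extV d n v i = n * extP d p i * (1 + relDev d n p v i) := by
  have hn' : (n : ℝ) ≠ 0 := by exact_mod_cast hn
  have hs : Real.sqrt n * Real.sqrt n = n := Real.mul_self_sqrt (Nat.cast_nonneg n)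
  have e : relDev d n p v i = (extV d n v i - n * extP d p i) / (n * extP d p i) := by
    rw [relDev, del, div_div, ← mul_assoc, hs]
  rw [e]
  field_simp
  ring

lemma quadForm_delVec {d n : ℕ} (hn : n ≠ 0) {p : Fin d → ℝ} (hp : ∀ i, extP d p i ≠ 0)
    (v : Fin d → ℝ) :
    quadForm d p (delVec d n p v) = ∑ i, n * extP d p i * relDev d n p v i ^ 2 := by
  have hn' : (0 : ℝ) < n := by positivity
  have hs : Real.sqrt n ^ 2 = n := Real.sq_sqrt (Nat.cast_nonneg n)
  have hs0 : Real.sqrt n ≠ 0 := by positivity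
  have h1 : ∀ i, p i ≠ 0 := fun i => by simpa [extP] using hp i.castSucc
  have h2 : 1 - ∑ i, p i ≠ 0 := by simpa [extP] using hp (Fin.last d)
  have e : ∀ i, n * extP d p i * relDev d n p v i ^ 2 =
      del n (extP d p i) (extV d n v i) ^ 2 / extP d p i := by
    intro i
    have := hp i
    rw [relDev, div_pow, mul_pow, hs]
    field_simp
  rw [quadForm_eq h1 h2, Finset.sum_congr rfl fun i _ => e i, Fin.sum_univ_castSucc]
  have hl : del n (extP d p (Fin.last d)) (extV d n v (Fin.last d)) =
      -∑ i, delVec d n p v i := by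
    simp only [extP, extV, del, delVec, Fin.snoc_last, ← Finset.sum_div, Finset.sum_sub_distrib,
      ← Finset.mul_sum]
    ring
  rw [hl, neg_sq]
  simp [extP, extV, delVec]

/-- Extended count vector: `k` on `Fin d`, together with `n - ∑ k`. -/
def extK (d n : ℕ) (k : Fin d → ℕ) : Fin (d + 1) → ℕ :=
  Fin.snoc k (n - ∑ i, k i)

lemma cast_extK {d n : ℕ} {k : Fin d → ℕ} (hk : ∑ i, k i ≤ n) (i : Fin (d + 1)) :
    (extK d n k i : ℝ) = extV d n (castK d k) i := by
  refine Fin.lastCases ?_ (fun j => ?_) i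
  · simp [extK, extV, castK, Nat.cast_sub hk]
  · simp [extK, extV, castK]

lemma sum_extP (d : ℕ) (p : Fin d → ℝ) : ∑ i, extP d p i = 1 := by
  simp [Fin.sum_univ_castSucc, extP]

lemma sum_extK {d n : ℕ} {k : Fin d → ℕ} (hk : ∑ i, k i ≤ n) :
    ∑ i, (extK d n k i : ℝ) = n := by
  simp [Fin.sum_univ_castSucc, extK, Nat.cast_sub hk]

lemma log_multinomialPMF {d n : ℕ} {p : Fin d → ℝ} (hp : ∀ i, 0 < extP d p i)
    {k : Fin d → ℕ} (hk : ∑ i, k i ≤ n) :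
    Real.log (multinomialPMF d n p k) = Real.log n.factorial +
      ∑ i, (extK d n k i * Real.log (extP d p i) - Real.log (extK d n k i).factorial) := by
  have e : multinomialPMF d n p k = (n.factorial : ℝ) /
      (∏ i, ((extK d n k i).factorial : ℝ)) * ∏ i, extP d p i ^ extK d n k i := by
    simp [multinomialPMF, hk, Fin.prod_univ_castSucc, extK, extP]
  have hf : ∀ m : ℕ, (m.factorial : ℝ) ≠ 0 := fun m => by positivity
  have hpow : ∀ i, extP d p i ^ extK d n k i ≠ 0 := fun i => (pow_pos (hp i) _).ne'
  rw [e, Real.log_mul (div_ne_zero (hf _) (Finset.prod_ne_zero_iff.2 fun i _ => hf _))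
      (Finset.prod_ne_zero_iff.2 fun i _ => hpow i),
    Real.log_div (hf _) (Finset.prod_ne_zero_iff.2 fun i _ => hf _),
    Real.log_prod fun i _ => hf _, Real.log_prod fun i _ => hpow i, Finset.sum_sub_distrib]
  simp only [Real.log_pow]
  ring

lemma multinomialPMF_pos {d n : ℕ} {p : Fin d → ℝ} (hp : ∀ i, 0 < extP d p i)
    {k : Fin d → ℕ} (hk : ∑ i, k i ≤ n) : 0 < multinomialPMF d n p k := by
  have h1 : ∀ i, 0 < p i := fun i => by simpa [extP] using hp i.castSucc
  have h2 : 0 < 1 - ∑ i, p i := by simpa [extP] using hp (Fin.last d)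
  have h3 : 0 < ∏ i, p i ^ k i := Finset.prod_pos fun i _ => pow_pos (h1 i) _
  rw [multinomialPMF, if_pos hk]
  positivity

/-- Exact decomposition of the log-ratio. -/
lemma logRatio_eq {d n : ℕ} (hn : n ≠ 0) {p : Fin d → ℝ} (hp : ∀ i, 0 < extP d p i)
    {k : Fin d → ℕ} (hk : ∑ i, k i ≤ n) (hk0 : ∀ i, extK d n k i ≠ 0) :
    logRatio d n p k = stirlingErr n - ∑ i, (stirlingErr (extK d n k i) +
      n * extP d p i * ((1 + relDev d n p (castK d k) i) *
        Real.log (1 + relDev d n p (castK d k) i) - relDev d n p (castK d k) i -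
          relDev d n p (castK d k) i ^ 2 / 2) +
      Real.log (1 + relDev d n p (castK d k) i) / 2) := by
  have hn' : (0 : ℝ) < n := by positivity
  have hK : ∀ i, (extK d n k i : ℝ) =
      n * extP d p i * (1 + relDev d n p (castK d k) i) := fun i => by
    rw [cast_extK hk, extV_eq_mul_one_add_relDev hn (hp i).ne']
  have hx : ∀ i, 0 < 1 + relDev d n p (castK d k) i := fun i => by
    have h : (0 : ℝ) < extK d n k i := by exact_mod_cast Nat.pos_of_ne_zero (hk0 i)
    rw [hK] at h
    exact pos_of_mul_pos_right h (mul_pos hn' (hp i)).le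
  have hprod : 0 < ∏ i, extP d p i := Finset.prod_pos fun i _ => hp i
  have hpi : (0 : ℝ) < (2 * Real.pi) ^ d := by positivity
  have hg : Real.log (gaussDens d p (delVec d n p (castK d k))) =
      -(1 / 2) * ∑ i, n * extP d p i * relDev d n p (castK d k) i ^ 2 -
        (d * Real.log (2 * Real.pi) + ∑ i, Real.log (extP d p i)) / 2 := by
    rw [gaussDens, Real.log_div (Real.exp_ne_zero _) (by positivity), Real.log_exp,
      Real.log_sqrt (by positivity), Real.log_mul hpi.ne' hprod.ne', Real.log_pow,
      Real.log_prod fun i _ => (hp i).ne', quadForm_delVec hn fun i => (hp i).ne']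
  have hg0 : gaussDens d p (delVec d n p (castK d k)) ≠ 0 := by
    rw [gaussDens]
    positivity
  rw [logRatio, Real.log_div (multinomialPMF_pos hp hk).ne' (by positivity),
    Real.log_mul (by positivity) hg0, Real.log_rpow hn', hg, log_multinomialPMF hp hk]
  have key : ∀ i, stirlingErr (extK d n k i) +
      n * extP d p i * ((1 + relDev d n p (castK d k) i) *
        Real.log (1 + relDev d n p (castK d k) i) - relDev d n p (castK d k) i -
          relDev d n p (castK d k) i ^ 2 / 2) +
      Real.log (1 + relDev d n p (castK d k) i) / 2 =
      -(extK d n k i * Real.log (extP d p i) - Real.log (extK d n k i).factorial)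
      - n * extP d p i * relDev d n p (castK d k) i ^ 2 / 2 - Real.log (extP d p i) / 2
      - (Real.log n + Real.log (2 * Real.pi)) / 2
      + n * extP d p i - extK d n k i * Real.log n := by
    intro i
    rw [stirlingErr, hK, Real.log_mul (mul_pos hn' (hp i)).ne' (hx i).ne',
      Real.log_mul hn'.ne' (hp i).ne']
    ring
  rw [Finset.sum_congr rfl fun i _ => key i]
  simp only [Finset.sum_add_distrib, Finset.sum_sub_distrib, Finset.sum_neg_distrib,
    ← Finset.sum_div, ← Finset.mul_sum, ← Finset.sum_mul, sum_extP, sum_extK hk,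
    Finset.sum_const, Finset.card_univ, Fintype.card_fin, nsmul_eq_mul, stirlingErr]
  push_cast
  ring

lemma logRatio_zero (n : ℕ) (p : Fin 0 → ℝ) (k : Fin 0 → ℕ) : logRatio 0 n p k = 0 := by
  have : (n.factorial : ℝ) ≠ 0 := by positivity
  simp [logRatio, multinomialPMF, gaussDens, quadForm, extP, Fin.snoc, this]

lemma log_le_mul_sqrt {n : ℕ} (hn : (16 : ℝ) ≤ n) : Real.log n ≤ 0.7 * Real.sqrt n := by
  have hs : (4 : ℝ) ≤ Real.sqrt n := Real.le_sqrt_of_sq_le (by norm_num; exact_mod_cast hn)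
  have h4 : Real.log 4 < 1.3863 := by
    have : (4 : ℝ) = 2 ^ 2 := by norm_num
    rw [this, Real.log_pow]
    have := Real.log_two_lt_d9
    norm_num at this ⊢
    linarith
  have h1 : Real.log (Real.sqrt n / 4) ≤ Real.sqrt n / 4 - 1 :=
    Real.log_le_sub_one_of_pos (by positivity)
  rw [Real.log_div (by positivity) (by norm_num), Real.log_sqrt (by positivity)] at h1
  linarith

lemma one_le_log {n : ℕ} (hn : (16 : ℝ) ≤ n) : 1 ≤ Real.log n := by
  rw [Real.le_log_iff_exp_le (by linarith)]
  linarith [Real.exp_one_lt_d9]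

lemma abs_logRatio_le {d n : ℕ} (hn : n ≠ 0) {p : Fin d → ℝ} (hp : ∀ i, 0 < extP d p i)
    {τ η : ℝ} (hτ : ∀ i, (extP d p i)⁻¹ ≤ τ) {k : Fin d → ℕ} (hk : ∑ i, k i ≤ n)
    (hk0 : ∀ i, extK d n k i ≠ 0) (hη : η ≤ 0.95)
    (hx : ∀ i, |relDev d n p (castK d k) i| ≤ η) :
    |logRatio d n p k| ≤
      1 / (12 * n) + ((d + 1) * (τ / (0.6 * n)) + 39.5 * n * η ^ 3 + (d + 1) * (10 * η)) := by
  have hn' : (0 : ℝ) < n := by positivity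
  rw [logRatio_eq hn hp hk hk0]
  refine (abs_sub _ _).trans (add_le_add ?_ ?_)
  · rw [abs_of_nonneg (stirlingErr_nonneg hn)]
    exact stirlingErr_le hn
  have hterm : ∀ i, |stirlingErr (extK d n k i) +
      n * extP d p i * ((1 + relDev d n p (castK d k) i) *
        Real.log (1 + relDev d n p (castK d k) i) - relDev d n p (castK d k) i -
          relDev d n p (castK d k) i ^ 2 / 2) +
      Real.log (1 + relDev d n p (castK d k) i) / 2| ≤
      τ / (0.6 * n) + extP d p i * (39.5 * n * η ^ 3) + 10 * η := by
    intro i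
    have hxi := hx i
    have hpi := hp i
    have h95 := hxi.trans hη
    refine (abs_add_le _ _).trans (add_le_add ((abs_add_le _ _).trans (add_le_add ?_ ?_)) ?_)
    · rw [abs_of_nonneg (stirlingErr_nonneg (hk0 i))]
      refine (stirlingErr_le (hk0 i)).trans ?_
      have hK : n * extP d p i * 0.05 ≤ extK d n k i := by
        rw [cast_extK hk, extV_eq_mul_one_add_relDev hn hpi.ne']
        have := (abs_le.1 h95).1
        exact mul_le_mul_of_nonneg_left (by linarith) (by positivity)
      calc 1 / (12 * (extK d n k i : ℝ)) ≤ 1 / (12 * (n * extP d p i * 0.05)) :=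
            one_div_le_one_div_of_le (by positivity) (by linarith)
        _ = (extP d p i)⁻¹ / (0.6 * n) := by
            field_simp
            norm_num
        _ ≤ τ / (0.6 * n) := div_le_div_of_nonneg_right (hτ i) (by positivity)
    · rw [abs_mul, abs_of_pos (mul_pos hn' hpi)]
      have h := (abs_entropy_sub_quadratic_le h95).trans
        (mul_le_mul_of_nonneg_left (pow_le_pow_left₀ (abs_nonneg _) hxi 3) (by norm_num))
      have := mul_le_mul_of_nonneg_left h (mul_pos hn' hpi).le
      linarith
    · rw [abs_div, abs_two]
      have := abs_log_one_add_le h95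
      linarith
  refine (Finset.abs_sum_le_sum_abs _ _).trans ((Finset.sum_le_sum fun i _ => hterm i).trans ?_)
  simp only [Finset.sum_add_distrib, ← Finset.sum_mul, sum_extP, Finset.sum_const,
    Finset.card_univ, Fintype.card_fin, nsmul_eq_mul]
  push_cast
  linarith

/-- **Rough bound on the log-ratio over the slightly enlarged bulk.** -/
theorem stmt17 (d : ℕ) (τ : ℝ) (hτ : (d : ℝ) + 1 ≤ τ) (n : ℕ) (hn : τ ^ 4 ≤ (n : ℝ))
    (p : Fin d → ℝ) (hp : p ∈ Ptau d τ) (k : Fin d → ℕ)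
    (hk0 : ∀ i, 0 < k i) (hkn : ∑ i, k i < n)
    (hkb : ∀ i : Fin (d + 1),
      |del n (extP d p i) (extV d n (castK d k) i) / (Real.sqrt n * extP d p i)| ≤
        1.076 * τ * Real.sqrt (Real.log n / n)) :
    |logRatio d n p k| ≤
      96.25 * τ ^ 3 * Real.log n ^ ((3 : ℝ) / 2) / (n : ℝ) ^ ((1 : ℝ) / 2) := by
  rcases Nat.eq_zero_or_pos d with rfl | hd
  · rw [logRatio_zero, abs_zero]
    have : 0 ≤ τ := by
      norm_num at hτ
      linarith
    have := Real.log_natCast_nonneg n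
    positivity
  have hd' : (1 : ℝ) ≤ d := by exact_mod_cast hd
  have hτ2 : 2 ≤ τ := by linarith
  have hn16 : (16 : ℝ) ≤ n := by
    have := pow_le_pow_left₀ (by norm_num) hτ2 4
    norm_num at this
    linarith
  have hn' : (0 : ℝ) < n := by linarith
  have hP : ∀ i, 0 < extP d p i := by
    intro i
    refine Fin.lastCases ?_ (fun j => ?_) i
    · simpa [extP] using hp.1.2
    · simpa [extP] using (hp.1.1 j).1
  have hK0 : ∀ i, extK d n k i ≠ 0 := by
    intro i
    refine Fin.lastCases ?_ (fun j => ?_) i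
    · simpa [extK] using Nat.sub_ne_zero_of_lt hkn
    · simpa [extK] using (hk0 j).ne'
  set s := Real.sqrt n with hs
  set r := Real.sqrt (Real.log n) with hr
  have hL1 := one_le_log hn16
  have hs2 : s ^ 2 = n := Real.sq_sqrt hn'.le
  have hr2 : r ^ 2 = Real.log n := Real.sq_sqrt (by linarith)
  have hr1 : 1 ≤ r := Real.one_le_sqrt.2 hL1
  have hs4 : 4 ≤ s := Real.le_sqrt_of_sq_le (by norm_num; exact_mod_cast hn16)
  have hrs : r ^ 2 ≤ 0.7 * s := hr2 ▸ log_le_mul_sqrt hn16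
  have hτs : τ ^ 2 ≤ s := Real.le_sqrt_of_sq_le (by rw [← pow_mul]; exact hn)
  have hη : 1.076 * τ * Real.sqrt (Real.log n / n) = 1.076 * τ * r / s := by
    rw [Real.sqrt_div (by linarith), mul_div_assoc]
  have hη95 : 1.076 * τ * r / s ≤ 0.95 := by
    rw [div_le_iff₀ (by linarith)]
    refine abs_le_of_sq_le_sq' ?_ (by positivity) |>.2
    have := mul_le_mul hτs hrs (by positivity) (by linarith)
    nlinarith
  have hmain := abs_logRatio_le (by rintro rfl; norm_num at hn16) hP hp.2 hkn.le hK0 hη95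
    fun i => hη ▸ hkb i
  have e1 : Real.log n ^ ((3 : ℝ) / 2) = r ^ 3 := by
    rw [hr, Real.sqrt_eq_rpow, ← Real.rpow_mul_natCast (by linarith)]
    norm_num
  rw [e1, ← Real.sqrt_eq_rpow, ← hs]
  refine hmain.trans ?_
  rw [← hs2]
  have hτ0 : 0 < τ := by linarith
  have hr0 : 0 < r := by linarith
  have hs0 : 0 < s := by linarith
  have hT1 : τ ^ 2 * r ≤ τ ^ 3 * r ^ 3 :=
    mul_le_mul (pow_le_pow_right₀ (by linarith) (by norm_num)) (le_self_pow₀ hr1 (by norm_num))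
      hr0.le (by positivity)
  have hT2 : τ ^ 2 ≤ τ ^ 2 * r := le_mul_of_one_le_right (by positivity) hr1
  have hT3 : 1 ≤ τ ^ 2 := one_le_pow₀ (by linarith)
  have b1 : 1 / (12 * s ^ 2) ≤ 1 * (τ ^ 3 * r ^ 3) / s := by
    rw [div_le_div_iff₀ (by positivity) hs0]
    nlinarith [mul_pos hs0 hs0]
  have b2 : ((d : ℝ) + 1) * (τ / (0.6 * s ^ 2)) ≤ 2 * (τ ^ 3 * r ^ 3) / s := by
    refine (mul_le_mul_of_nonneg_right hτ (by positivity)).trans ?_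
    rw [← mul_div_assoc, div_le_div_iff₀ (by positivity) hs0]
    have h := mul_le_mul (hT2.trans hT1) (by linarith : (1 : ℝ) ≤ s) zero_le_one (by positivity)
    have := mul_le_mul_of_nonneg_right h hs0.le
    nlinarith [mul_pos (mul_pos hτ0 hτ0) hs0]
  have b3 : 39.5 * s ^ 2 * (1.076 * τ * r / s) ^ 3 ≤ 50 * (τ ^ 3 * r ^ 3) / s := by
    have : 39.5 * s ^ 2 * (1.076 * τ * r / s) ^ 3 =
        (39.5 * 1.076 ^ 3) * (τ ^ 3 * r ^ 3) / s := by
      field_simp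
    rw [this]
    gcongr
    norm_num
  have b4 : ((d : ℝ) + 1) * (10 * (1.076 * τ * r / s)) ≤ 11 * (τ ^ 3 * r ^ 3) / s := by
    refine (mul_le_mul_of_nonneg_right hτ (by positivity)).trans ?_
    have : τ * (10 * (1.076 * τ * r / s)) = 10.76 * (τ ^ 2 * r) / s := by
      field_simp
      norm_num
    rw [this]
    gcongr
    norm_num
  have hT : 0 ≤ τ ^ 3 * (r ^ 3 / s) := by positivity
  have e2 : 96.25 * τ ^ 3 * r ^ 3 / s = 96.25 * (τ ^ 3 * (r ^ 3 / s)) := by ring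
  rw [e2]
  simp only [mul_div_assoc] at b1 b2 b3 b4 ⊢
  linarith
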